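/- Let n ≥ 1 be an integer, let p ∈ ℂ with 0 < |p| < 1, and let s, z_1, ..., z_{n−1}, y_1, ..., y_n ∈ ℂ, all nonzero, with θ(y_i²;p) ≠ 0 for all i, and θ(y_i y_j;p) ≠ 0 and θ(y_i/y_j;p) ≠ 0 for all i < j. Then Σ_{σ ∈ {±1}^n} ∏_{1≤i<j≤n} θ(s² y_i^{σ_i} y_j^{σ_j};p)/θ(y_i^{σ_i} y_j^{σ_j};p) · ∏_{i=1}^{n} ( ∏_{r=1}^{n−1} θ(z_r y_i^{σ_i}/s;p) θ(y_i^{σ_i}/(s z_r);p) ) / ( y_i^{(n−2)σ_i} θ(y_i^{2σ_i};p) ) = 0. (Here s plays the role of u^{1/2}, i.e. u = s².) -/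

import Mathlib

open scoped BigOperators Real

/-- The theta function `θ(x;p)`. -/
noncomputable def ellTheta (x p : ℂ) : ℂ :=
  ∏' k : ℕ, ((1 - p ^ k * x) * (1 - p ^ (k + 1) / x))

/-- `z^{σ}`: `z` if the sign is `+1` (`true`), `z⁻¹` if the sign is `−1` (`false`). -/
noncomputable def pw (z : ℂ) (b : Bool) : ℂ := if b then z else z⁻¹

open Filter Topology

/-- The two-sided series `∑ q^(n²) xⁿ`. -/
noncomputable def thetaSeries (q x : ℂ) : ℂ := ∑' n : ℤ, q ^ (n ^ 2) * x ^ n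

lemma exists_exp_eq_of_norm_lt_one {q : ℂ} (hq0 : q ≠ 0) (hq1 : ‖q‖ < 1) :
    ∃ τ : ℂ, 0 < τ.im ∧ Complex.exp (π * Complex.I * τ) = q := by
  have hpi : (π : ℂ) ≠ 0 := by exact_mod_cast Real.pi_ne_zero
  have h : Complex.exp (π * Complex.I * (Complex.log q / (π * Complex.I))) = q := by
    rw [mul_div_cancel₀ _ (mul_ne_zero hpi Complex.I_ne_zero), Complex.exp_log hq0]
  refine ⟨_, ?_, h⟩
  rw [← h, Complex.norm_exp, Real.exp_lt_one_iff] at hq1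
  generalize Complex.log q / (π * Complex.I) = τ at hq1
  have : ((π : ℂ) * Complex.I * τ).re = -(π * τ.im) := by simp
  rw [this] at hq1
  exact pos_of_mul_pos_right (by linarith) Real.pi_pos.le

lemma jacobiTheta₂_term_eq_zpow (n : ℤ) (z τ : ℂ) :
    jacobiTheta₂_term n z τ =
      Complex.exp (π * Complex.I * τ) ^ (n ^ 2) * Complex.exp (2 * π * Complex.I * z) ^ n := by
  rw [jacobiTheta₂_term, ← Complex.exp_int_mul, ← Complex.exp_int_mul, ← Complex.exp_add]
  congr 1
  push_cast
  ring

lemma exp_two_pi_I_mul_div (w : ℂ) :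
    Complex.exp (2 * π * Complex.I * (w / (2 * π * Complex.I))) = Complex.exp w := by
  rw [mul_div_cancel₀ _ Complex.two_pi_I_ne_zero]

lemma summable_thetaSeries {q x : ℂ} (hq0 : q ≠ 0) (hq1 : ‖q‖ < 1) (hx : x ≠ 0) :
    Summable fun n : ℤ => q ^ (n ^ 2) * x ^ n := by
  obtain ⟨τ, hτ, rfl⟩ := exists_exp_eq_of_norm_lt_one hq0 hq1
  have := (summable_jacobiTheta₂_term_iff (Complex.log x / (2 * π * Complex.I)) τ).2 hτ
  simpa only [jacobiTheta₂_term_eq_zpow, exp_two_pi_I_mul_div, Complex.exp_log hx] using this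

lemma differentiableAt_thetaSeries {q x : ℂ} (hq0 : q ≠ 0) (hq1 : ‖q‖ < 1) (hx : x ≠ 0) :
    DifferentiableAt ℂ (thetaSeries q) x := by
  obtain ⟨τ, hτ, rfl⟩ := exists_exp_eq_of_norm_lt_one hq0 hq1
  have hd : DifferentiableAt ℂ (fun y => jacobiTheta₂
      ((Complex.log (y / x) + Complex.log x) / (2 * π * Complex.I)) τ) x := by
    have h1 : DifferentiableAt ℂ (fun y =>
        (Complex.log (y / x) + Complex.log x) / (2 * π * Complex.I)) x := by
      refine DifferentiableAt.div_const (DifferentiableAt.add_const _ ?_) _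
      refine DifferentiableAt.clog (by fun_prop) ?_
      rw [div_self hx]
      exact Complex.one_mem_slitPlane
    exact DifferentiableAt.comp x (differentiableAt_jacobiTheta₂_fst _ hτ) h1
  refine hd.congr_of_eventuallyEq ?_
  filter_upwards [isOpen_ne.mem_nhds hx] with y hy
  simp only [thetaSeries, jacobiTheta₂, jacobiTheta₂_term_eq_zpow, exp_two_pi_I_mul_div]
  rw [Complex.exp_add, Complex.exp_log (div_ne_zero hy hx), Complex.exp_log hx, div_mul_cancel₀ _ hx]

lemma thetaSeries_inv (q x : ℂ) : thetaSeries q x⁻¹ = thetaSeries q x := by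
  rw [thetaSeries, ← (Equiv.neg ℤ).tsum_eq]
  simp [thetaSeries]

lemma thetaSeries_shift {q x : ℂ} (hq0 : q ≠ 0) (hx : x ≠ 0) :
    thetaSeries q x = q * x * thetaSeries q (q ^ 2 * x) := by
  rw [thetaSeries, ← (Equiv.addRight (1 : ℤ)).tsum_eq, thetaSeries, ← tsum_mul_left]
  refine tsum_congr fun n => ?_
  have : q ^ ((n + 1) ^ 2) = q ^ (n ^ 2) * (q ^ (2 : ℕ)) ^ n * q := by
    rw [← zpow_natCast q 2, ← zpow_mul, ← zpow_add₀ hq0, ← zpow_add_one₀ hq0]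
    congr 1
    push_cast
    ring
  simp only [Equiv.coe_addRight, this, zpow_add_one₀ hx, mul_zpow]
  ring

/-- Pairs of integers, split by the parity of their sum and written as `(u + v, u - v)` or
`(u + v + 1, u - v)`. -/
def intPairParityEquiv : (ℤ × ℤ) ⊕ (ℤ × ℤ) ≃ ℤ × ℤ where
  toFun := Sum.elim (fun a => (a.1 + a.2, a.1 - a.2)) (fun a => (a.1 + a.2 + 1, a.1 - a.2))
  invFun b := if (b.1 + b.2) % 2 = 0 then Sum.inl ((b.1 + b.2) / 2, (b.1 - b.2) / 2)
    else Sum.inr ((b.1 + b.2) / 2, (b.1 - b.2) / 2)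
  left_inv := by
    rintro (⟨u, v⟩ | ⟨u, v⟩)
    · have h : (u + v + (u - v)) % 2 = 0 := by omega
      simp only [Sum.elim_inl, h, if_true, Sum.inl.injEq, Prod.mk.injEq]
      omega
    · have h : ¬ (u + v + 1 + (u - v)) % 2 = 0 := by omega
      simp only [Sum.elim_inr, h, if_false, Sum.inr.injEq, Prod.mk.injEq]
      omega
  right_inv := by
    rintro ⟨k, l⟩
    by_cases h : (k + l) % 2 = 0
    · simp only [h, if_true, Sum.elim_inl, Prod.mk.injEq]
      omega
    · simp only [h, if_false, Sum.elim_inr, Prod.mk.injEq]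
      omega

lemma thetaSeries_mul {q x y : ℂ} (hq0 : q ≠ 0) (hq1 : ‖q‖ < 1) (hx : x ≠ 0) (hy : y ≠ 0) :
    thetaSeries q x * thetaSeries q y =
      thetaSeries (q ^ 2) (x * y) * thetaSeries (q ^ 2) (x / y) +
      q * x * (thetaSeries (q ^ 2) (q ^ 2 * (x * y)) * thetaSeries (q ^ 2) (q ^ 2 * (x / y))) := by
  have hQ0 : q ^ 2 ≠ 0 := pow_ne_zero 2 hq0
  have hQ1 : ‖q ^ 2‖ < 1 := by
    rw [norm_pow]
    exact pow_lt_one₀ (norm_nonneg _) hq1 two_ne_zero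
  have hxy := mul_ne_zero hx hy
  have hxdy := div_ne_zero hx hy
  have s1 := (summable_thetaSeries hq0 hq1 hx).norm
  have s2 := (summable_thetaSeries hq0 hq1 hy).norm
  have t1 := (summable_thetaSeries hQ0 hQ1 hxy).norm
  have t2 := (summable_thetaSeries hQ0 hQ1 hxdy).norm
  have t3 := (summable_thetaSeries hQ0 hQ1 (mul_ne_zero hQ0 hxy)).norm
  have t4 := (summable_thetaSeries hQ0 hQ1 (mul_ne_zero hQ0 hxdy)).norm
  have hS := (intPairParityEquiv.summable_iff).2 (summable_mul_of_summable_norm s1 s2)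
  simp only [Function.comp_def] at hS
  simp only [thetaSeries]
  rw [tsum_mul_tsum_of_summable_norm s1 s2, tsum_mul_tsum_of_summable_norm t1 t2,
    tsum_mul_tsum_of_summable_norm t3 t4, ← intPairParityEquiv.tsum_eq,
    Summable.tsum_sum (hS.comp_injective Sum.inl_injective)
      (hS.comp_injective Sum.inr_injective),
    ← tsum_mul_left]
  congr 1
  · refine tsum_congr fun a => ?_
    obtain ⟨u, v⟩ := a
    simp only [intPairParityEquiv, Equiv.coe_fn_mk, Sum.elim_inl]
    have e : q ^ ((u + v) ^ 2) * q ^ ((u - v) ^ 2) = (q ^ 2) ^ (u ^ 2) * (q ^ 2) ^ (v ^ 2) := by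
      rw [← zpow_natCast q 2, ← zpow_mul, ← zpow_mul, ← zpow_add₀ hq0, ← zpow_add₀ hq0]
      congr 1
      push_cast
      ring
    have e' : x ^ (u + v) * y ^ (u - v) = (x * y) ^ u * (x / y) ^ v := by
      rw [zpow_add₀ hx, zpow_sub₀ hy, mul_zpow, div_zpow]
      ring
    calc _ = (q ^ ((u + v) ^ 2) * q ^ ((u - v) ^ 2)) * (x ^ (u + v) * y ^ (u - v)) := by ring
      _ = _ := by rw [e, e']; ring
  · refine tsum_congr fun a => ?_
    obtain ⟨u, v⟩ := a
    simp only [intPairParityEquiv, Equiv.coe_fn_mk, Sum.elim_inr]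
    have e : q ^ ((u + v + 1) ^ 2) * q ^ ((u - v) ^ 2) =
        q * ((q ^ 2) ^ (u ^ 2) * (q ^ 2) ^ (v ^ 2) * (q ^ 2) ^ u * (q ^ 2) ^ v) := by
      simp only [← zpow_natCast q 2, ← zpow_mul, ← zpow_add₀ hq0, ← zpow_one_add₀ hq0]
      congr 1
      push_cast
      ring
    have e' : x ^ (u + v + 1) * y ^ (u - v) = x * ((x * y) ^ u * (x / y) ^ v) := by
      rw [zpow_add_one₀ hx, zpow_add₀ hx, zpow_sub₀ hy, mul_zpow, div_zpow]
      ring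
    rw [mul_zpow (q ^ 2), mul_zpow (q ^ 2)]
    calc _ = (q ^ ((u + v + 1) ^ 2) * q ^ ((u - v) ^ 2)) * (x ^ (u + v + 1) * y ^ (u - v)) := by
          ring
      _ = _ := by rw [e, e']; ring

/-- The finite `p`-Pochhammer product `(p; p)_m`. -/
noncomputable def qPoch (p : ℂ) (m : ℕ) : ℂ := ∏ k ∈ Finset.range m, (1 - p ^ (k + 1))

/-- The reciprocal `1 / (p; p)_m`, extended by zero to negative `m`. -/
noncomputable def qPochInv (p : ℂ) (m : ℤ) : ℂ := if 0 ≤ m then (qPoch p m.toNat)⁻¹ else 0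

lemma one_sub_pow_ne_zero {p : ℂ} (hp1 : ‖p‖ < 1) (k : ℕ) : 1 - p ^ (k + 1) ≠ 0 := by
  intro h
  have : ‖p ^ (k + 1)‖ < 1 := by
    rw [norm_pow]
    exact pow_lt_one₀ (norm_nonneg _) hp1 k.succ_ne_zero
  rw [← sub_eq_zero.1 h] at this
  simp at this

lemma qPoch_ne_zero {p : ℂ} (hp1 : ‖p‖ < 1) (m : ℕ) : qPoch p m ≠ 0 :=
  Finset.prod_ne_zero_iff.2 fun k _ => one_sub_pow_ne_zero hp1 k

lemma qPochInv_sub_one {p : ℂ} (hp1 : ‖p‖ < 1) (m : ℤ) :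
    qPochInv p (m - 1) = (1 - p ^ m) * qPochInv p m := by
  rcases lt_trichotomy m 0 with h | rfl | h
  · simp [qPochInv, show ¬ 0 ≤ m by omega, show ¬ 1 ≤ m by omega]
  · simp [qPochInv]
  · obtain ⟨k, rfl⟩ : ∃ k : ℕ, m = k + 1 := ⟨(m - 1).toNat, by omega⟩
    have h1 : ((k : ℤ) + 1).toNat = k + 1 := by omega
    have h2 := one_sub_pow_ne_zero hp1 k
    have h3 := qPoch_ne_zero hp1 k
    have h4 : p ^ ((k : ℤ) + 1) = p ^ (k + 1) := by exact_mod_cast zpow_natCast p (k + 1)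
    simp only [qPochInv, add_sub_cancel_right, Int.natCast_nonneg, if_true, Int.toNat_natCast,
      show (0 : ℤ) ≤ k + 1 by omega, h1, h4]
    rw [show qPoch p (k + 1) = qPoch p k * (1 - p ^ (k + 1)) from Finset.prod_range_succ _ _]
    field_simp

lemma summable_norm_pow {p : ℂ} (hp1 : ‖p‖ < 1) : Summable fun k : ℕ => ‖p ^ k‖ := by
  simpa only [norm_pow] using summable_geometric_of_lt_one (norm_nonneg p) hp1

lemma exists_tendsto_qPoch {p : ℂ} (hp1 : ‖p‖ < 1) :
    ∃ P : ℂ, P ≠ 0 ∧ Tendsto (qPoch p) atTop (𝓝 P) := by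
  have hs : Summable fun k : ℕ => ‖-p ^ (k + 1)‖ := by
    simpa only [norm_neg] using (summable_nat_add_iff 1).2 (summable_norm_pow hp1)
  refine ⟨∏' k : ℕ, (1 + -p ^ (k + 1)), tprod_one_add_ne_zero_of_summable (fun k => ?_) hs, ?_⟩
  · simpa [sub_eq_add_neg] using one_sub_pow_ne_zero hp1 k
  · have h : qPoch p = fun m => ∏ k ∈ Finset.range m, (1 + -p ^ (k + 1)) := by
      funext m
      simp only [qPoch, sub_eq_add_neg]
    rw [h]
    exact (multipliable_one_add_of_summable hs).hasProd.tendsto_prod_nat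

/-- The Laurent coefficients of the finite Jacobi triple product, with `p = q²`. -/
noncomputable def jacobiCoeff (q : ℂ) (N : ℕ) (j : ℤ) : ℂ :=
  (-1) ^ j * q ^ (j ^ 2 - j) *
    (qPoch (q ^ 2) (2 * N) * qPochInv (q ^ 2) (N + j) * qPochInv (q ^ 2) (N - j))

lemma jacobiCoeff_succ {q : ℂ} (hq0 : q ≠ 0) (hp1 : ‖q ^ 2‖ < 1) (N : ℕ) (j : ℤ) :
    jacobiCoeff q (N + 1) j = (1 + (q ^ 2) ^ (2 * N + 1)) * jacobiCoeff q N j -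
      (q ^ 2) ^ N * jacobiCoeff q N (j - 1) - (q ^ 2) ^ (N + 1) * jacobiCoeff q N (j + 1) := by
  have hp0 : q ^ 2 ≠ 0 := pow_ne_zero 2 hq0
  have r1 := qPochInv_sub_one hp1 (N + 1 + j)
  have r2 := qPochInv_sub_one hp1 (N + 1 - j)
  have r3 := qPochInv_sub_one hp1 (N + j)
  have r4 := qPochInv_sub_one hp1 (N - j)
  rw [show (N + 1 + j - 1 : ℤ) = N + j by ring] at r1
  rw [show (N + 1 - j - 1 : ℤ) = N - j by ring] at r2
  have hP : qPoch (q ^ 2) (2 * (N + 1)) =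
      qPoch (q ^ 2) (2 * N) * (1 - (q ^ 2) ^ (2 * N + 1)) * (1 - (q ^ 2) ^ (2 * N + 2)) := by
    rw [show 2 * (N + 1) = 2 * N + 1 + 1 by ring, qPoch, Finset.prod_range_succ,
      Finset.prod_range_succ, qPoch]
  simp only [jacobiCoeff]
  rw [show ((N + 1 : ℕ) : ℤ) + j = N + 1 + j by push_cast; ring,
    show ((N + 1 : ℕ) : ℤ) - j = N + 1 - j by push_cast; ring,
    show (N : ℤ) + (j - 1) = N + j - 1 by ring, show (N : ℤ) - (j - 1) = N + 1 - j by ring,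
    show (N : ℤ) + (j + 1) = N + 1 + j by ring, show (N : ℤ) - (j + 1) = N - j - 1 by ring,
    r3, r4, r1, r2, hP]
  generalize qPochInv (q ^ 2) (N + 1 + j) = R
  generalize qPochInv (q ^ 2) (N + 1 - j) = S
  generalize qPoch (q ^ 2) (2 * N) = P
  have e1 : q ^ ((j - 1) ^ 2 - (j - 1)) = q ^ (j ^ 2 - j) * ((q ^ 2) ^ j)⁻¹ * q ^ 2 := by
    rw [← zpow_natCast q 2, ← zpow_mul, ← zpow_neg, ← zpow_add₀ hq0, ← zpow_add₀ hq0]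
    congr 1
    push_cast
    ring
  have e2 : q ^ ((j + 1) ^ 2 - (j + 1)) = q ^ (j ^ 2 - j) * (q ^ 2) ^ j := by
    rw [← zpow_natCast q 2, ← zpow_mul, ← zpow_add₀ hq0]
    congr 1
    push_cast
    ring
  have h1 : (-1 : ℂ) ≠ 0 := by norm_num
  rw [e1, e2, zpow_sub_one₀ h1, zpow_add_one₀ h1]
  generalize q ^ (j ^ 2 - j) = E
  generalize (-1 : ℂ) ^ j = ε
  generalize hp : q ^ 2 = p at hp0
  have hB : p ^ j ≠ 0 := zpow_ne_zero _ hp0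
  simp only [zpow_add₀ hp0, zpow_sub₀ hp0, zpow_natCast, zpow_one, pow_add, pow_mul, pow_one]
  rw [← pow_mul p 2 N, mul_comm 2 N, pow_mul p N 2]
  generalize p ^ j = B at hB
  generalize p ^ N = A
  field_simp
  ring

lemma hasSum_jacobiCoeff {q x : ℂ} (hq0 : q ≠ 0) (hp1 : ‖q ^ 2‖ < 1) (hx : x ≠ 0) (N : ℕ) :
    HasSum (fun j : ℤ => jacobiCoeff q N j * x ^ j)
      (∏ k ∈ Finset.range N, ((1 - (q ^ 2) ^ k * x) * (1 - (q ^ 2) ^ (k + 1) / x))) := by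
  induction N with
  | zero =>
    have h := hasSum_single (f := fun j : ℤ => jacobiCoeff q 0 j * x ^ j) 0 (by
      intro j hj
      rcases lt_or_gt_of_ne hj with h | h
      · simp [jacobiCoeff, qPochInv, not_le.2 h]
      · simp [jacobiCoeff, qPochInv, not_le.2 h])
    simpa [jacobiCoeff, qPochInv, qPoch] using h
  | succ N ih =>
    rw [Finset.prod_range_succ]
    generalize (∏ k ∈ Finset.range N, ((1 - (q ^ 2) ^ k * x) * (1 - (q ^ 2) ^ (k + 1) / x))) = W
      at ih ⊢
    have h1 := (Equiv.subRight (1 : ℤ)).hasSum_iff.2 ih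
    have h2 := (Equiv.addRight (1 : ℤ)).hasSum_iff.2 ih
    have h := ((ih.mul_left (1 + (q ^ 2) ^ (2 * N + 1))).sub
      (h1.mul_left ((q ^ 2) ^ N * x))).sub (h2.mul_left ((q ^ 2) ^ (N + 1) / x))
    have hf : (fun j : ℤ => jacobiCoeff q (N + 1) j * x ^ j) = fun j : ℤ =>
        (1 + (q ^ 2) ^ (2 * N + 1)) * (jacobiCoeff q N j * x ^ j) -
        (q ^ 2) ^ N * x * (jacobiCoeff q N (j - 1) * x ^ (j - 1)) -
        (q ^ 2) ^ (N + 1) / x * (jacobiCoeff q N (j + 1) * x ^ (j + 1)) := by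
      funext j
      rw [jacobiCoeff_succ hq0 hp1, zpow_sub_one₀ hx, zpow_add_one₀ hx]
      field_simp
    have hW : W * ((1 - (q ^ 2) ^ N * x) * (1 - (q ^ 2) ^ (N + 1) / x)) =
        (1 + (q ^ 2) ^ (2 * N + 1)) * W - (q ^ 2) ^ N * x * W - (q ^ 2) ^ (N + 1) / x * W := by
      field_simp
      ring
    rw [hf, hW]
    exact h

lemma multipliable_ellTheta {p : ℂ} (hp1 : ‖p‖ < 1) (x : ℂ) :
    Multipliable fun k : ℕ => (1 - p ^ k * x) * (1 - p ^ (k + 1) / x) := by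
  have h1 : Summable fun k : ℕ => ‖-(p ^ k * x)‖ := by
    simpa only [norm_neg, norm_mul] using (summable_norm_pow hp1).mul_right ‖x‖
  have h2 : Summable fun k : ℕ => ‖-(p ^ (k + 1) / x)‖ := by
    simpa only [norm_neg, norm_div] using
      ((summable_nat_add_iff 1).2 (summable_norm_pow hp1)).div_const ‖x‖
  simpa only [sub_eq_add_neg] using
    (multipliable_one_add_of_summable h1).mul (multipliable_one_add_of_summable h2)

lemma exists_norm_le_of_tendsto {u : ℕ → ℂ} {a : ℂ} (h : Tendsto u atTop (𝓝 a)) :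
    ∃ B, ∀ n, ‖u n‖ ≤ B := by
  obtain ⟨B, hB⟩ := (Metric.isBounded_range_of_tendsto u h).exists_norm_le
  exact ⟨B, fun n => hB _ ⟨n, rfl⟩⟩

/-- The Jacobi triple product identity, up to the value of the constant. -/
theorem exists_ellTheta_eq_thetaSeries {q : ℂ} (hq0 : q ≠ 0) (hq1 : ‖q‖ < 1) :
    ∃ C : ℂ, ∀ x : ℂ, x ≠ 0 → ellTheta x (q ^ 2) = C * thetaSeries q (-x / q) := by
  have hp1 : ‖q ^ 2‖ < 1 := by
    rw [norm_pow]
    exact pow_lt_one₀ (norm_nonneg _) hq1 two_ne_zero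
  obtain ⟨P, hP0, hP⟩ := exists_tendsto_qPoch hp1
  have hI := hP.inv₀ hP0
  obtain ⟨B, hB⟩ := exists_norm_le_of_tendsto hP
  obtain ⟨D, hD⟩ := exists_norm_le_of_tendsto hI
  have hD0 : 0 ≤ D := (norm_nonneg _).trans (hD 0)
  have hB0 : 0 ≤ B := (norm_nonneg _).trans (hB 0)
  have hD' : ∀ m, ‖qPochInv (q ^ 2) m‖ ≤ D := by
    intro m
    rw [qPochInv]
    split_ifs
    · exact hD _
    · simpa using hD0
  have hI' : Tendsto (qPochInv (q ^ 2)) atTop (𝓝 P⁻¹) := by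
    have ht : Tendsto Int.toNat atTop atTop :=
      tendsto_atTop_atTop.2 fun b => ⟨b, fun a ha => by omega⟩
    refine (hI.comp ht).congr' ?_
    filter_upwards [eventually_ge_atTop 0] with m hm
    simp [qPochInv, hm]
  refine ⟨P * P⁻¹ * P⁻¹, fun x hx => ?_⟩
  have hterm : ∀ j : ℤ, q ^ (j ^ 2) * (-x / q) ^ j = (-1) ^ j * q ^ (j ^ 2 - j) * x ^ j := by
    intro j
    rw [div_zpow, neg_eq_neg_one_mul, mul_zpow, zpow_sub₀ hq0]
    ring
  have hsum := summable_thetaSeries hq0 hq1 (div_ne_zero (neg_ne_zero.2 hx) hq0)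
  have hlim := tendsto_tsum_of_dominated_convergence (𝓕 := atTop)
    (f := fun N j => jacobiCoeff q N j * x ^ j)
    (g := fun j => P * P⁻¹ * P⁻¹ * (q ^ (j ^ 2) * (-x / q) ^ j))
    (hsum.norm.mul_left (B * D * D)) ?_ ?_
  · rw [tsum_mul_left] at hlim
    refine tendsto_nhds_unique ?_ hlim
    simp only [fun N => (hasSum_jacobiCoeff hq0 hp1 hx N).tsum_eq]
    exact (multipliable_ellTheta hp1 x).hasProd.tendsto_prod_nat
  · intro j
    have a1 : Tendsto (fun N : ℕ => qPoch (q ^ 2) (2 * N)) atTop (𝓝 P) :=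
      hP.comp (tendsto_id.const_mul_atTop' two_pos)
    have a2 : Tendsto (fun N : ℕ => qPochInv (q ^ 2) (N + j)) atTop (𝓝 P⁻¹) :=
      hI'.comp (tendsto_atTop_add_const_right _ _ tendsto_natCast_atTop_atTop)
    have a3 : Tendsto (fun N : ℕ => qPochInv (q ^ 2) (N + -j)) atTop (𝓝 P⁻¹) :=
      hI'.comp (tendsto_atTop_add_const_right _ _ tendsto_natCast_atTop_atTop)
    refine (((a1.mul a2).mul a3).mul_const (q ^ (j ^ 2) * (-x / q) ^ j)).congr fun N => ?_
    rw [hterm, jacobiCoeff, ← sub_eq_add_neg]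
    ring
  · refine Eventually.of_forall fun N j => ?_
    have : jacobiCoeff q N j * x ^ j = qPoch (q ^ 2) (2 * N) * qPochInv (q ^ 2) (N + j) *
        qPochInv (q ^ 2) (N - j) * (q ^ (j ^ 2) * (-x / q) ^ j) := by
      rw [hterm, jacobiCoeff]
      ring
    rw [this, norm_mul, norm_mul, norm_mul]
    gcongr
    · exact hB _
    · exact hD' _
    · exact hD' _

section EllThetaProperties

variable {p : ℂ}

lemma exists_sq_eq_of_norm_lt_one (hp0 : 0 < ‖p‖) (hp1 : ‖p‖ < 1) :
    ∃ q : ℂ, q ≠ 0 ∧ ‖q‖ < 1 ∧ q ^ 2 = p := by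
  obtain ⟨q, hq⟩ := IsAlgClosed.exists_pow_nat_eq p two_pos
  refine ⟨q, ?_, ?_, hq⟩
  · rintro rfl
    rw [← hq] at hp0
    simp at hp0
  · rw [← hq, norm_pow] at hp1
    exact (pow_lt_one_iff_of_nonneg (norm_nonneg q) two_ne_zero).1 hp1

lemma differentiableAt_ellTheta (hp0 : 0 < ‖p‖) (hp1 : ‖p‖ < 1) {x : ℂ} (hx : x ≠ 0) :
    DifferentiableAt ℂ (fun x => ellTheta x p) x := by
  obtain ⟨q, hq0, hq1, rfl⟩ := exists_sq_eq_of_norm_lt_one hp0 hp1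
  obtain ⟨C, hC⟩ := exists_ellTheta_eq_thetaSeries hq0 hq1
  have hd : DifferentiableAt ℂ (fun x => C * thetaSeries q (-x / q)) x := by
    refine DifferentiableAt.const_mul ?_ _
    have h := differentiableAt_thetaSeries hq0 hq1 (div_ne_zero (neg_ne_zero.2 hx) hq0)
    exact h.comp x (by fun_prop : DifferentiableAt ℂ (fun x : ℂ => -x / q) x)
  refine hd.congr_of_eventuallyEq ?_
  filter_upwards [isOpen_ne.mem_nhds hx] with y hy using hC y hy

lemma ellTheta_inv (hp0 : 0 < ‖p‖) (hp1 : ‖p‖ < 1) {x : ℂ} (hx : x ≠ 0) :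
    ellTheta x⁻¹ p = -x⁻¹ * ellTheta x p := by
  obtain ⟨q, hq0, hq1, rfl⟩ := exists_sq_eq_of_norm_lt_one hp0 hp1
  obtain ⟨C, hC⟩ := exists_ellTheta_eq_thetaSeries hq0 hq1
  rw [hC _ (inv_ne_zero hx), hC _ hx,
    thetaSeries_shift hq0 (div_ne_zero (neg_ne_zero.2 hx) hq0), ← thetaSeries_inv,
    show (-x⁻¹ / q)⁻¹ = q ^ 2 * (-x / q) by field_simp]
  field_simp

lemma ellTheta_one (hp0 : 0 < ‖p‖) (hp1 : ‖p‖ < 1) : ellTheta 1 p = 0 := by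
  have h := ellTheta_inv hp0 hp1 one_ne_zero
  rw [inv_one] at h
  linear_combination h / 2

/-- The products `θ(za) θ(a/z)` span, as functions of `z`, a space of dimension two. -/
lemma exists_ellTheta_mul_ellTheta (hp0 : 0 < ‖p‖) (hp1 : ‖p‖ < 1) :
    ∃ E O : ℂ → ℂ, ∀ z a : ℂ, z ≠ 0 → a ≠ 0 →
      ellTheta (z * a) p * ellTheta (a / z) p = a * (O a * E z - E a * O z) := by
  obtain ⟨q, hq0, hq1, rfl⟩ := exists_sq_eq_of_norm_lt_one hp0 hp1
  obtain ⟨C, hC⟩ := exists_ellTheta_eq_thetaSeries hq0 hq1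
  refine ⟨fun z => C * thetaSeries (q ^ 2) (z ^ 2),
    fun z => C * (z * thetaSeries (q ^ 2) (q ^ 2 * z ^ 2)), fun z a hz ha => ?_⟩
  have hza := mul_ne_zero hz ha
  have haz := div_ne_zero ha hz
  have h := thetaSeries_mul hq0 hq1 (div_ne_zero (neg_ne_zero.2 hza) hq0)
    (div_ne_zero (neg_ne_zero.2 haz) hq0)
  have e1 : -(z * a) / q * (-(a / z) / q) = a ^ 2 / q ^ 2 := by field_simp
  have e2 : -(z * a) / q / (-(a / z) / q) = z ^ 2 := by field_simp
  have e3 : q ^ 2 * (a ^ 2 / q ^ 2) = a ^ 2 := by field_simp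
  have e4 : (q ^ 2) ^ 2 * (a ^ 2 / q ^ 2) = q ^ 2 * a ^ 2 := by field_simp
  have e5 : q * (-(z * a) / q) = -(z * a) := by field_simp
  rw [e1, e2, e5, thetaSeries_shift (pow_ne_zero 2 hq0) (x := a ^ 2 / q ^ 2) (by positivity),
    e3, e4] at h
  rw [hC _ hza, hC _ haz]
  linear_combination C ^ 2 * h

lemma eventually_ellTheta_sq_mul_ne_zero (hp0 : 0 < ‖p‖) (hp1 : ‖p‖ < 1) {w c s₀ : ℂ}
    (hw0 : w ≠ 0) (hw : ellTheta w p ≠ 0) (hc : c ≠ 0) (hs₀ : s₀ ≠ 0) :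
    ∀ᶠ s in 𝓝[≠] s₀, ellTheta (s ^ 2 * c) p ≠ 0 := by
  have hd : DifferentiableOn ℂ (fun s => ellTheta (s ^ 2 * c) p) {0}ᶜ := by
    intro s hs
    have h := differentiableAt_ellTheta hp0 hp1 (mul_ne_zero (pow_ne_zero 2 hs) hc)
    exact (h.comp s (by fun_prop :
      DifferentiableAt ℂ (fun s : ℂ => s ^ 2 * c) s)).differentiableWithinAt
  have ha := hd.analyticOnNhd isOpen_compl_singleton
  rcases (ha s₀ hs₀).eventually_eq_zero_or_eventually_ne_zero with h | h
  · exfalso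
    obtain ⟨s, hs⟩ := IsAlgClosed.exists_pow_nat_eq (w / c) two_pos
    have hs0 : s ≠ 0 := by
      rintro rfl
      exact div_ne_zero hw0 hc (by simpa using hs.symm)
    have hz := ha.eqOn_zero_of_preconnected_of_eventuallyEq_zero
      (isConnected_compl_singleton_of_one_lt_rank (by simp) 0).isPreconnected hs₀ h hs0
    simp only [hs, div_mul_cancel₀ _ hc, Pi.zero_apply] at hz
    exact hw hz
  · exact h

end EllThetaProperties

section BinaryForms

variable {K : Type*} [Field K]

lemma exists_coeff_prod_linear (N : ℕ) (α β : Fin N → K) :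
    ∃ d : Fin (N + 1) → K, ∀ X Y : K,
      ∏ i, (α i * X + β i * Y) = ∑ j : Fin (N + 1), X ^ j.1 * Y ^ j.rev.1 * d j := by
  induction N with
  | zero => exact ⟨fun _ => 1, fun X Y => by simp⟩
  | succ N ih =>
    obtain ⟨d, hd⟩ := ih (fun i => α i.succ) (fun i => β i.succ)
    refine ⟨fun j => Fin.cons (α := fun _ => K) 0 (fun i => α 0 * d i) j +
      Fin.snoc (α := fun _ => K) (fun i => β 0 * d i) 0 j, fun X Y => ?_⟩
    simp only [mul_add, Finset.sum_add_distrib]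
    rw [Fin.prod_univ_succ, hd, add_mul, Finset.mul_sum, Finset.mul_sum]
    nth_rewrite 3 [Fin.sum_univ_succ]
    nth_rewrite 4 [Fin.sum_univ_castSucc]
    simp only [Fin.cons_zero, Fin.cons_succ, Fin.snoc_last, Fin.snoc_castSucc, mul_zero, zero_add,
      add_zero, Fin.val_succ, Fin.rev_succ, Fin.rev_castSucc, Fin.val_castSucc]
    congr 1 <;> refine Finset.sum_congr rfl fun j _ => ?_ <;> ring

/-- A binary form of degree `N` vanishing at `N + 1` pairwise non-proportional points vanishes. -/
lemma sum_prod_linear_eq_zero {ι : Type*} [Fintype ι] {N : ℕ} (c : ι → K) (α β : ι → Fin N → K)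
    (v w : Fin (N + 1) → K) (hvw : ∀ i j, i < j → v j * w i - v i * w j ≠ 0)
    (hzero : ∀ k, ∑ t, c t * ∏ i, (α t i * v k + β t i * w k) = 0) (X Y : K) :
    ∑ t, c t * ∏ i, (α t i * X + β t i * Y) = 0 := by
  choose d hd using fun t => exists_coeff_prod_linear N (α t) (β t)
  have key : ∀ X Y, ∑ t, c t * ∏ i, (α t i * X + β t i * Y) =
      ∑ j : Fin (N + 1), X ^ j.1 * Y ^ j.rev.1 * ∑ t, c t * d t j := by
    intro X Y
    simp only [hd, Finset.mul_sum]
    rw [Finset.sum_comm]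
    refine Finset.sum_congr rfl fun j _ => Finset.sum_congr rfl fun t _ => ?_
    ring
  have hdet : (Matrix.projVandermonde v w).det ≠ 0 := by
    rw [Matrix.det_projVandermonde]
    exact Finset.prod_ne_zero_iff.2 fun i _ => Finset.prod_ne_zero_iff.2 fun j hj =>
      hvw i j (Finset.mem_Ioi.1 hj)
  have hcoeff := Matrix.eq_zero_of_mulVec_eq_zero hdet (v := fun j => ∑ t, c t * d t j) (by
    funext k
    rw [Pi.zero_apply, ← hzero k, key]
    rfl)
  rw [key]
  exact Finset.sum_eq_zero fun j _ => by rw [congrFun hcoeff j, Pi.zero_apply, mul_zero]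

end BinaryForms

lemma pw_ne_zero {z : ℂ} (hz : z ≠ 0) (b : Bool) : pw z b ≠ 0 := by
  cases b <;> simp [pw, hz]

lemma pw_not (z : ℂ) (b : Bool) : pw z (!b) = (pw z b)⁻¹ := by
  cases b <;> simp [pw]

section PairProducts

variable {R : Type*} [CommMonoid R]

lemma prod_prod_ite_insertNth {α : Type*} (g : α → α → R) (hg : ∀ a b, g a b = g b a) {n : ℕ}
    (k : Fin (n + 1)) (a : α) (x : Fin n → α) :
    (∏ i, ∏ j, if i < j then g (k.insertNth (α := fun _ => α) a x i)
        (k.insertNth (α := fun _ => α) a x j) else 1) =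
      (∏ j, g a (x j)) * ∏ i, ∏ j, if i < j then g (x i) (x j) else 1 := by
  rw [Fin.prod_univ_succAbove _ k]
  simp only [Fin.prod_univ_succAbove _ k, Fin.insertNth_apply_same, Fin.insertNth_apply_succAbove,
    lt_irrefl, if_false, one_mul, Fin.succAbove_lt_succAbove_iff, Finset.prod_mul_distrib]
  rw [← mul_assoc, ← Finset.prod_mul_distrib]
  congr 1
  refine Finset.prod_congr rfl fun j _ => ?_
  rcases lt_or_gt_of_ne (Fin.succAbove_ne k j) with h | h
  · rw [if_neg h.not_gt, if_pos h, one_mul, hg]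
  · rw [if_pos h, if_neg h.not_gt, mul_one]

end PairProducts

/-- The summand of the symmetrized theta sum, as a function of `x i = y i ^ σ i`. -/
noncomputable def thetaSummand (p s : ℂ) {m : ℕ} (z : Fin m → ℂ) (x : Fin (m + 1) → ℂ) : ℂ :=
  (∏ i, ∏ j, if i < j then
      ellTheta (s ^ 2 * (x i * x j)) p / ellTheta (x i * x j) p else 1) *
    ∏ i, (∏ r, ellTheta (z r * x i / s) p * ellTheta (x i / (s * z r)) p) /
      (x i ^ (((m + 1 : ℕ) : ℤ) - 2) * ellTheta (x i ^ 2) p)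

/-- The symmetrized theta sum. -/
noncomputable def thetaSymSum (p s : ℂ) {m : ℕ} (z : Fin m → ℂ) (y : Fin (m + 1) → ℂ) : ℂ :=
  ∑ σ : Fin (m + 1) → Bool, thetaSummand p s z fun i => pw (y i) (σ i)

/-- The nonvanishing conditions on `y` that make the symmetrized theta sum well defined. -/
structure IsRegularTuple (p : ℂ) {n : ℕ} (y : Fin n → ℂ) : Prop where
  ne_zero : ∀ i, y i ≠ 0
  sq : ∀ i, ellTheta (y i ^ 2) p ≠ 0
  mul : ∀ i j, i ≠ j → ellTheta (y i * y j) p ≠ 0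
  div : ∀ i j, i ≠ j → ellTheta (y i / y j) p ≠ 0

section Vanishing

variable {p : ℂ}

lemma ellTheta_inv_ne_zero (hp0 : 0 < ‖p‖) (hp1 : ‖p‖ < 1) {x : ℂ} (hx : x ≠ 0)
    (h : ellTheta x p ≠ 0) : ellTheta x⁻¹ p ≠ 0 := by
  rw [ellTheta_inv hp0 hp1 hx]
  exact mul_ne_zero (neg_ne_zero.2 (inv_ne_zero hx)) h

lemma IsRegularTuple.succAbove {n : ℕ} {y : Fin (n + 1) → ℂ} (hy : IsRegularTuple p y)
    (k : Fin (n + 1)) : IsRegularTuple p fun i => y (k.succAbove i) where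
  ne_zero _ := hy.ne_zero _
  sq _ := hy.sq _
  mul _ _ hij := hy.mul _ _ fun h => hij (Fin.succAbove_right_injective h)
  div _ _ hij := hy.div _ _ fun h => hij (Fin.succAbove_right_injective h)

lemma IsRegularTuple.ellTheta_pw_mul_pw_ne_zero (hp0 : 0 < ‖p‖) (hp1 : ‖p‖ < 1) {n : ℕ}
    {y : Fin n → ℂ} (hy : IsRegularTuple p y) {i j : Fin n} (hij : i ≠ j) (b c : Bool) :
    ellTheta (pw (y i) b * pw (y j) c) p ≠ 0 := by
  have hi := hy.ne_zero i
  have hj := hy.ne_zero j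
  cases b <;> cases c <;> simp only [pw, if_true, if_false, Bool.false_eq_true]
  · rw [← mul_inv]
    exact ellTheta_inv_ne_zero hp0 hp1 (mul_ne_zero hi hj) (hy.mul i j hij)
  · rw [← div_eq_inv_mul]
    exact hy.div j i hij.symm
  · rw [← div_eq_mul_inv]
    exact hy.div i j hij
  · exact hy.mul i j hij

/-- The function `θ(ux) θ(x/u) / x` is invariant under `x ↦ 1/x`. -/
lemma ellTheta_mul_div_pw (hp0 : 0 < ‖p‖) (hp1 : ‖p‖ < 1) {u x : ℂ} (hu : u ≠ 0) (hx : x ≠ 0)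
    (b : Bool) :
    ellTheta (u * pw x b) p * ellTheta (pw x b / u) p / pw x b =
      ellTheta (u * x) p * ellTheta (x / u) p / x := by
  cases b
  · simp only [pw, Bool.false_eq_true, if_false]
    rw [show u * x⁻¹ = (x / u)⁻¹ by field_simp, show x⁻¹ / u = (u * x)⁻¹ by field_simp,
      ellTheta_inv hp0 hp1 (div_ne_zero hx hu), ellTheta_inv hp0 hp1 (mul_ne_zero hu hx)]
    field_simp
  · simp [pw]

lemma thetaSummand_cons_insertNth {s : ℂ} (hs : s ≠ 0) {m : ℕ} (z : Fin m → ℂ)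
    (k : Fin (m + 2)) {a : ℂ} (ha : a ≠ 0) (x : Fin (m + 1) → ℂ) (hx : ∀ i, x i ≠ 0)
    (hax : ∀ i, ellTheta (a * x i) p ≠ 0) :
    thetaSummand p s (Fin.cons (α := fun _ => ℂ) (s * a) z)
        (k.insertNth (α := fun _ => ℂ) a x) =
      (∏ r, ellTheta (Fin.cons (α := fun _ => ℂ) (s * a) z r * a / s) p *
          ellTheta (a / (s * Fin.cons (α := fun _ => ℂ) (s * a) z r)) p) /
        (a ^ (((m + 1 + 1 : ℕ) : ℤ) - 2) * ellTheta (a ^ 2) p) *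
      (∏ i, ellTheta (s ^ 2 * a * x i) p * ellTheta (x i / (s ^ 2 * a)) p / x i) *
      thetaSummand p s z x := by
  have hz : (((m + 1 + 1 : ℕ) : ℤ) - 2) = (((m + 1 : ℕ) : ℤ) - 2) + 1 := by
    push_cast
    ring
  rw [thetaSummand, prod_prod_ite_insertNth
    (fun a b => ellTheta (s ^ 2 * (a * b)) p / ellTheta (a * b) p)
    (fun a b => by rw [mul_comm a b]), Fin.prod_univ_succAbove _ k]
  simp only [Fin.insertNth_apply_same, Fin.insertNth_apply_succAbove]
  have key : (∏ j, ellTheta (s ^ 2 * (a * x j)) p / ellTheta (a * x j) p) *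
      ∏ i, (∏ r, ellTheta (Fin.cons (α := fun _ => ℂ) (s * a) z r * x i / s) p *
          ellTheta (x i / (s * Fin.cons (α := fun _ => ℂ) (s * a) z r)) p) /
        (x i ^ (((m + 1 + 1 : ℕ) : ℤ) - 2) * ellTheta (x i ^ 2) p) =
      (∏ i, ellTheta (s ^ 2 * a * x i) p * ellTheta (x i / (s ^ 2 * a)) p / x i) *
      ∏ i, (∏ r, ellTheta (z r * x i / s) p * ellTheta (x i / (s * z r)) p) /
        (x i ^ (((m + 1 : ℕ) : ℤ) - 2) * ellTheta (x i ^ 2) p) := by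
    rw [← Finset.prod_mul_distrib, ← Finset.prod_mul_distrib]
    refine Finset.prod_congr rfl fun i _ => ?_
    rw [Fin.prod_univ_succ]
    simp only [Fin.cons_zero, Fin.cons_succ]
    rw [show s * a * x i / s = a * x i by field_simp, show s * (s * a) = s ^ 2 * a by ring,
      ← mul_assoc (s ^ 2), hz, zpow_add_one₀ (hx i)]
    have h := hax i
    generalize ellTheta (a * x i) p = t at h
    have h' := hx i
    have h'' := zpow_ne_zero (((m + 1 : ℕ) : ℤ) - 2) h'
    generalize (x i) ^ (((m + 1 : ℕ) : ℤ) - 2) = w at h''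
    simp only [div_eq_mul_inv, mul_inv]
    field_simp
  rw [thetaSummand]
  linear_combination (∏ i, ∏ j, if i < j then
      ellTheta (s ^ 2 * (x i * x j)) p / ellTheta (x i * x j) p else 1) *
    ((∏ r, ellTheta (Fin.cons (α := fun _ => ℂ) (s * a) z r * a / s) p *
          ellTheta (a / (s * Fin.cons (α := fun _ => ℂ) (s * a) z r)) p) /
        (a ^ (((m + 1 + 1 : ℕ) : ℤ) - 2) * ellTheta (a ^ 2) p)) * key

lemma thetaSummand_eq_zero (hp0 : 0 < ‖p‖) (hp1 : ‖p‖ < 1) {s : ℂ} (hs : s ≠ 0) {m : ℕ}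
    (z : Fin m → ℂ) (x : Fin (m + 1) → ℂ) {i : Fin (m + 1)} {r : Fin m} (hx : x i ≠ 0)
    (hz : z r = s * (x i)⁻¹) : thetaSummand p s z x = 0 := by
  rw [thetaSummand]
  refine mul_eq_zero_of_right _ (Finset.prod_eq_zero (Finset.mem_univ i) ?_)
  rw [Finset.prod_eq_zero (Finset.mem_univ r), zero_div]
  rw [hz, show s * (x i)⁻¹ * x i / s = 1 by field_simp, ellTheta_one hp0 hp1, zero_mul]

/-- Specializing one parameter to `s y_k^{±1}` reduces the symmetrized sum to a smaller one. -/
lemma thetaSymSum_cons_eq_zero (hp0 : 0 < ‖p‖) (hp1 : ‖p‖ < 1) {s : ℂ} (hs : s ≠ 0) {m : ℕ}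
    (z : Fin m → ℂ) {y : Fin (m + 2) → ℂ} (hy : IsRegularTuple p y) (k : Fin (m + 2))
    (hsmall : thetaSymSum p s z (fun i => y (k.succAbove i)) = 0) (b : Bool) :
    thetaSymSum p s (Fin.cons (α := fun _ => ℂ) (s * pw (y k) b) z) y = 0 := by
  have hk := hy.ne_zero k
  have hins : ∀ (c : Bool) (σ : Fin (m + 1) → Bool),
      (fun i => pw (y i) (k.insertNth (α := fun _ => Bool) c σ i)) =
        k.insertNth (α := fun _ => ℂ) (pw (y k) c) fun i => pw (y (k.succAbove i)) (σ i) := by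
    intro c σ
    rw [Fin.eq_insertNth_iff]
    exact ⟨by simp, by funext i; simp [Fin.removeNth]⟩
  rw [thetaSymSum, ← (Fin.insertNthEquiv (fun _ => Bool) k).sum_comp, Fintype.sum_prod_type,
    Fintype.sum_eq_single b]
  · simp only [Fin.insertNthEquiv_apply, hins]
    rw [Finset.sum_congr rfl fun σ _ => thetaSummand_cons_insertNth hs z k (pw_ne_zero hk b)
      (fun i => pw (y (k.succAbove i)) (σ i)) (fun i => pw_ne_zero (hy.ne_zero _) _)
      (fun i => hy.ellTheta_pw_mul_pw_ne_zero hp0 hp1 (Fin.succAbove_ne k i).symm _ _)]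
    have hu : s ^ 2 * pw (y k) b ≠ 0 := mul_ne_zero (pow_ne_zero 2 hs) (pw_ne_zero hk b)
    simp only [fun i c => ellTheta_mul_div_pw hp0 hp1 hu (hy.ne_zero (k.succAbove i)) c]
    rw [← Finset.mul_sum]
    exact mul_eq_zero_of_right _ hsmall
  · intro c hc
    refine Finset.sum_eq_zero fun σ _ => ?_
    simp only [Fin.insertNthEquiv_apply, hins]
    refine thetaSummand_eq_zero hp0 hp1 hs _ _ (i := k) (r := 0) ?_ ?_
    · simpa using pw_ne_zero hk c
    · rw [Fin.cons_zero, Fin.insertNth_apply_same, ← pw_not, Bool.eq_not_of_ne hc, Bool.not_not]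

/-- As a function of one of its parameters, the symmetrized sum is determined by its values at
`n + 1` points in general position. -/
lemma thetaSymSum_cons_eq_zero_of_points (hp0 : 0 < ‖p‖) (hp1 : ‖p‖ < 1) {s : ℂ} (hs : s ≠ 0)
    {m : ℕ} (z : Fin m → ℂ) {y : Fin (m + 2) → ℂ} (hy : ∀ i, y i ≠ 0) (a : Fin (m + 3) → ℂ)
    (ha : ∀ k, a k ≠ 0)
    (hgen : ∀ i j, i < j → ellTheta (a j * a i) p ≠ 0 ∧ ellTheta (a i / a j) p ≠ 0)
    (hzero : ∀ k, thetaSymSum p s (Fin.cons (α := fun _ => ℂ) (a k) z) y = 0)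
    {w : ℂ} (hw : w ≠ 0) :
    thetaSymSum p s (Fin.cons (α := fun _ => ℂ) w z) y = 0 := by
  obtain ⟨E, O, hEO⟩ := exists_ellTheta_mul_ellTheta hp0 hp1
  set x : (Fin (m + 2) → Bool) → Fin (m + 2) → ℂ := fun σ i => pw (y i) (σ i) / s with hxdef
  have hx : ∀ σ i, x σ i ≠ 0 := fun σ i => div_ne_zero (pw_ne_zero (hy i) _) hs
  have key : ∀ w : ℂ, w ≠ 0 → thetaSymSum p s (Fin.cons (α := fun _ => ℂ) w z) y =
      ∑ σ : Fin (m + 2) → Bool,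
        ((∏ i, ∏ j, if i < j then
            ellTheta (s ^ 2 * (pw (y i) (σ i) * pw (y j) (σ j))) p /
              ellTheta (pw (y i) (σ i) * pw (y j) (σ j)) p else 1) *
          ∏ i, (∏ r, ellTheta (z r * pw (y i) (σ i) / s) p *
            ellTheta (pw (y i) (σ i) / (s * z r)) p) /
            (pw (y i) (σ i) ^ (((m + 1 + 1 : ℕ) : ℤ) - 2) * ellTheta (pw (y i) (σ i) ^ 2) p)) *
        ∏ i, (x σ i * O (x σ i) * E w + -(x σ i * E (x σ i)) * O w) := by
    intro w hw
    rw [thetaSymSum]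
    refine Finset.sum_congr rfl fun σ _ => ?_
    rw [thetaSummand, mul_assoc]
    congr 1
    rw [← Finset.prod_mul_distrib]
    refine Finset.prod_congr rfl fun i _ => ?_
    rw [Fin.prod_univ_succ]
    simp only [Fin.cons_zero, Fin.cons_succ]
    rw [show w * pw (y i) (σ i) / s = w * x σ i from mul_div_assoc _ _ _,
      show pw (y i) (σ i) / (s * w) = x σ i / w from (div_div _ _ _).symm,
      hEO w (x σ i) hw (hx σ i)]
    ring
  rw [key w hw]
  refine sum_prod_linear_eq_zero _ _ _ (fun k => E (a k)) (fun k => O (a k)) (fun i j hij h => ?_)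
    (fun k => ?_) _ _
  · have h1 := hEO (a j) (a i) (ha j) (ha i)
    rw [show O (a i) * E (a j) - E (a i) * O (a j) = 0 by linear_combination h, mul_zero] at h1
    exact mul_ne_zero (hgen i j hij).1 (hgen i j hij).2 h1
  · rw [← key _ (ha k), hzero]

lemma thetaSymSum_eq_zero_of_generic (hp0 : 0 < ‖p‖) (hp1 : ‖p‖ < 1) {s : ℂ} (hs : s ≠ 0)
    {m : ℕ} (z : Fin (m + 1) → ℂ) (hz : ∀ r, z r ≠ 0) {y : Fin (m + 2) → ℂ}
    (hy : IsRegularTuple p y)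
    (hgen₁ : ∀ k, ellTheta (s ^ 2 * (y k / y 0)) p ≠ 0)
    (hgen₂ : ∀ i j, ellTheta (s ^ 2 * (y i * y j)) p ≠ 0)
    (hsmall : ∀ k : Fin (m + 2),
      thetaSymSum p s (fun r => z r.succ) (fun i => y (k.succAbove i)) = 0) :
    thetaSymSum p s z y = 0 := by
  have h0 := hy.ne_zero
  rw [← Fin.cons_self_tail (α := fun _ => ℂ) z]
  refine thetaSymSum_cons_eq_zero_of_points hp0 hp1 hs _ h0
    (Fin.cons (α := fun _ => ℂ) (s * (y 0)⁻¹) fun k => s * y k) ?_ ?_ ?_ (hz 0)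
  · intro k
    cases k using Fin.cases with
    | zero => simpa using ⟨hs, h0 0⟩
    | succ k => simpa using ⟨hs, h0 k⟩
  · intro i j hij
    cases j using Fin.cases with
    | zero => exact absurd hij (Fin.not_lt_zero i)
    | succ j =>
      have hj := h0 j
      cases i using Fin.cases with
      | zero =>
        have hy0 := h0 0
        simp only [Fin.cons_zero, Fin.cons_succ]
        rw [show s * y j * (s * (y 0)⁻¹) = s ^ 2 * (y j / y 0) by field_simp,
          show s * (y 0)⁻¹ / (s * y j) = (y j * y 0)⁻¹ by field_simp]
        refine ⟨hgen₁ j, ellTheta_inv_ne_zero hp0 hp1 (mul_ne_zero hj hy0) ?_⟩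
        by_cases hj0 : j = 0
        · rw [hj0, ← sq]
          exact hy.sq 0
        · exact hy.mul j 0 hj0
      | succ i =>
        simp only [Fin.cons_succ]
        rw [show s * y j * (s * y i) = s ^ 2 * (y j * y i) by ring,
          mul_div_mul_left _ _ hs]
        exact ⟨hgen₂ j i, hy.div i j (Fin.succ_lt_succ_iff.1 hij).ne⟩
  · intro k
    cases k using Fin.cases with
    | zero => exact thetaSymSum_cons_eq_zero hp0 hp1 hs _ hy 0 (hsmall 0) false
    | succ k => exact thetaSymSum_cons_eq_zero hp0 hp1 hs _ hy k (hsmall k) true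

lemma continuousAt_thetaSymSum (hp0 : 0 < ‖p‖) (hp1 : ‖p‖ < 1) {s : ℂ} (hs : s ≠ 0) {m : ℕ}
    (z : Fin m → ℂ) (hz : ∀ r, z r ≠ 0) (y : Fin (m + 1) → ℂ) (hy : ∀ i, y i ≠ 0) :
    ContinuousAt (fun s => thetaSymSum p s z y) s := by
  have hθ : ∀ f : ℂ → ℂ, ContinuousAt f s → f s ≠ 0 →
      ContinuousAt (fun s => ellTheta (f s) p) s := fun f hf h0 =>
    ContinuousAt.comp (g := fun x => ellTheta x p)
      (differentiableAt_ellTheta hp0 hp1 h0).continuousAt hf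
  refine tendsto_finsetSum _ fun σ _ => ?_
  have hx : ∀ i, pw (y i) (σ i) ≠ 0 := fun i => pw_ne_zero (hy i) _
  refine Tendsto.mul ?_ ?_
  · refine tendsto_finsetProd _ fun i _ => tendsto_finsetProd _ fun j _ => ?_
    split_ifs
    · refine Tendsto.div_const (hθ (fun s => s ^ 2 * (pw (y i) (σ i) * pw (y j) (σ j)))
        (by fun_prop) ?_) _
      exact mul_ne_zero (pow_ne_zero 2 hs) (mul_ne_zero (hx i) (hx j))
    · exact tendsto_const_nhds
  · refine tendsto_finsetProd _ fun i _ => Tendsto.div_const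
      (tendsto_finsetProd _ fun r _ => Tendsto.mul
        (hθ (fun s => z r * pw (y i) (σ i) / s) ?_ ?_)
        (hθ (fun s => pw (y i) (σ i) / (s * z r)) ?_ ?_)) _
    · exact ContinuousAt.div continuousAt_const continuousAt_id hs
    · exact div_ne_zero (mul_ne_zero (hz r) (hx i)) hs
    · exact ContinuousAt.div continuousAt_const (by fun_prop) (mul_ne_zero hs (hz r))
    · exact div_ne_zero (hx i) (mul_ne_zero hs (hz r))

theorem thetaSymSum_eq_zero (hp0 : 0 < ‖p‖) (hp1 : ‖p‖ < 1) {m : ℕ} {s : ℂ} (hs : s ≠ 0)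
    (z : Fin m → ℂ) (hz : ∀ r, z r ≠ 0) {y : Fin (m + 1) → ℂ} (hy : IsRegularTuple p y) :
    thetaSymSum p s z y = 0 := by
  induction m generalizing s with
  | zero =>
    have hy0 := hy.ne_zero 0
    have hsq := hy.sq 0
    have hinv := ellTheta_inv hp0 hp1 (pow_ne_zero 2 hy0)
    rw [thetaSymSum, ← (Equiv.funUnique (Fin 1) Bool).symm.sum_comp]
    simp only [Fintype.sum_bool, thetaSummand, pw, Fin.prod_univ_succ, Fin.prod_univ_zero,
      lt_irrefl, if_false, mul_one, one_mul,
      Equiv.funUnique_symm_apply, uniqueElim_const, if_true, Bool.false_eq_true, inv_pow, hinv]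
    norm_num
    field_simp
    ring
  | succ m ih =>
    have h0 := hy.ne_zero
    have hev : ∀ᶠ s' in 𝓝[≠] s, thetaSymSum p s' z y = 0 := by
      have e (c : ℂ) (hc : c ≠ 0) := eventually_ellTheta_sq_mul_ne_zero hp0 hp1
        (pow_ne_zero 2 (h0 0)) (hy.sq 0) hc hs
      have e₁ := eventually_all.2 fun k => e (y k / y 0) (div_ne_zero (h0 k) (h0 0))
      have e₂ := eventually_all.2 fun i => eventually_all.2 fun j =>
        e (y i * y j) (mul_ne_zero (h0 i) (h0 j))
      have e₃ : ∀ᶠ s' in 𝓝[≠] s, s' ≠ 0 := nhdsWithin_le_nhds (isOpen_ne.mem_nhds hs)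
      filter_upwards [e₁, e₂, e₃] with s' h₁ h₂ h₃
      exact thetaSymSum_eq_zero_of_generic hp0 hp1 h₃ z hz hy h₁ h₂ fun k =>
        ih h₃ _ (fun r => hz r.succ) (hy.succAbove k)
    have hc := (continuousAt_thetaSymSum hp0 hp1 hs z hz y h0).tendsto.mono_left
      (nhdsWithin_le_nhds (s := {s}ᶜ))
    exact tendsto_nhds_unique hc (tendsto_const_nhds.congr' (hev.mono fun _ h => h.symm))

end Vanishing

/-- Lemma (vanishing of a symmetrized theta sum, "Lemma vanishII"); here `s = u^{1/2}`. -/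
theorem vanishII (n : ℕ) (hn : 1 ≤ n) (p : ℂ)
    (hp0 : 0 < ‖p‖) (hp1 : ‖p‖ < 1)
    (s : ℂ) (z : Fin (n - 1) → ℂ) (y : Fin n → ℂ)
    (hs0 : s ≠ 0) (hz0 : ∀ r, z r ≠ 0) (hy0 : ∀ i, y i ≠ 0)
    (hy2 : ∀ i, ellTheta (y i ^ 2) p ≠ 0)
    (hyij : ∀ i j, i < j → ellTheta (y i * y j) p ≠ 0 ∧ ellTheta (y i / y j) p ≠ 0) :
    (∑ σ : Fin n → Bool,
      (∏ i, ∏ j, if i < j then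
        ellTheta (s ^ 2 * (pw (y i) (σ i) * pw (y j) (σ j))) p /
          ellTheta (pw (y i) (σ i) * pw (y j) (σ j)) p
      else 1) *
      ∏ i, (∏ r, ellTheta (z r * pw (y i) (σ i) / s) p *
          ellTheta (pw (y i) (σ i) / (s * z r)) p) /
        (pw (y i) (σ i) ^ ((n : ℤ) - 2) * ellTheta (pw (y i) (σ i) ^ 2) p)) = 0 := by
  obtain ⟨m, rfl⟩ : ∃ m, n = m + 1 := ⟨n - 1, by omega⟩
  have hreg : IsRegularTuple p y := by
    refine ⟨hy0, hy2, fun i j hij => ?_, fun i j hij => ?_⟩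
    · rcases lt_or_gt_of_ne hij with h | h
      · exact (hyij i j h).1
      · rw [mul_comm]
        exact (hyij j i h).1
    · rcases lt_or_gt_of_ne hij with h | h
      · exact (hyij i j h).2
      · rw [← inv_div]
        exact ellTheta_inv_ne_zero hp0 hp1 (div_ne_zero (hy0 j) (hy0 i)) (hyij j i h).2
  exact thetaSymSum_eq_zero hp0 hp1 hs0 z hz0 hreg
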